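/- Given a centered 1-dimensional 2-block CSBM with parameters n, p, q, σ such that p ≥ Ω(log²n / n), γ = (p−q)/(p+q) ≥ Ω(√(log n/(np))), and σ ≤ O(1/√n), with probability 1 − n^{−Ω(1)} the single-convolution output x₁ = Ãx satisfies ‖s − (1/η)x₁‖_∞ ≤ O( σ·( (1/γ)√(log n/(np)) + √(log n / n) ) ) + 1/(2√n), where η = (p−q)n/(2d). -/

import Mathlib

open MeasureTheory ProbabilityTheory Matrix

/-- Bernoulli measure on `Bool` with success probability `p`. -/
noncomputable def bern (p : ℝ) : Measure Bool :=
  ENNReal.ofReal (1 - p) • Measure.dirac false + ENNReal.ofReal p • Measure.dirac true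

/-- Edge randomness of the 2-block stochastic block model on `n` vertices:
independent Bernoulli variables, with probability `p` for pairs inside a class and `q`
across classes.  Class `S` consists of the first `n/2` vertices; only the upper triangle
is used to build the (symmetric) adjacency matrix. -/
noncomputable def sbm (n : ℕ) (p q : ℝ) : Measure (Fin n → Fin n → Bool) :=
  Measure.pi fun i => Measure.pi fun j =>
    bern (if ((i : ℕ) < n / 2 ↔ (j : ℕ) < n / 2) then p else q)

/-- The (symmetric, hollow) adjacency matrix built from the edge indicators. -/
noncomputable def adjM {n : ℕ} (ω : Fin n → Fin n → Bool) : Matrix (Fin n) (Fin n) ℝ :=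
  Matrix.of fun i j =>
    if i = j then 0 else if (if i ≤ j then ω i j else ω j i) then 1 else 0

/-- Empirical average degree `d = 2|E|/n`. -/
noncomputable def avgDeg {n : ℕ} (ω : Fin n → Fin n → Bool) : ℝ :=
  (∑ i, ∑ j, adjM ω i j) / n

/-- Corrected graph convolution matrix `Ã = (1/d)A - (1/n)𝟙𝟙ᵀ`. -/
noncomputable def tildeA {n : ℕ} (ω : Fin n → Fin n → Bool) : Matrix (Fin n) (Fin n) ℝ :=
  (avgDeg ω)⁻¹ • adjM ω - (n : ℝ)⁻¹ • Matrix.of (fun _ _ => (1 : ℝ))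

/-- The unit signal vector `s`, with entries `1/√n` on `S` and `-1/√n` on `T`. -/
noncomputable def sig (n : ℕ) : Fin n → ℝ :=
  fun i => if (i : ℕ) < n / 2 then (Real.sqrt n)⁻¹ else -(Real.sqrt n)⁻¹

/-- Spectral norm (ℓ²→ℓ² operator norm) of a real square matrix. -/
noncomputable def specNorm {n : ℕ} (M : Matrix (Fin n) (Fin n) ℝ) : ℝ :=
  ‖Matrix.toEuclideanCLM (𝕜 := ℝ) M‖

/-- Gaussian noise for the centered 1-dimensional features. -/
noncomputable def gauss1 (n : ℕ) (σ : ℝ) : Measure (Fin n → ℝ) :=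
  Measure.pi fun _ : Fin n => gaussianReal 0 (Real.toNNReal (σ ^ 2))

/-! ### Concentration for independent Bernoulli edges -/

lemma bern_isProbabilityMeasure {r : ℝ} (h0 : 0 ≤ r) (h1 : r ≤ 1) :
    IsProbabilityMeasure (bern r) := by
  constructor
  simp only [bern, Measure.add_apply, Measure.smul_apply, measure_univ, smul_eq_mul, mul_one]
  rw [← ENNReal.ofReal_add (by linarith) h0]
  simp

lemma integral_bern {r : ℝ} (h0 : 0 ≤ r) (h1 : r ≤ 1) (f : Bool → ℝ) :
    ∫ x, f x ∂(bern r) = (1 - r) * f false + r * f true := by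
  have := bern_isProbabilityMeasure h0 h1
  rw [bern, integral_add_measure, integral_smul_measure, integral_smul_measure, integral_dirac,
    integral_dirac, ENNReal.toReal_ofReal (by linarith), ENNReal.toReal_ofReal h0]
  · simp
  · exact (integrable_dirac (by simp)).smul_measure (by simp)
  · exact (integrable_dirac (by simp)).smul_measure (by simp)

/-- Bernstein-type bound on the moment generating function of a centred Bernoulli variable. -/
lemma integral_exp_bern_le {r u : ℝ} (h0 : 0 ≤ r) (h1 : r ≤ 1) (hu : |u| ≤ 1) :
    ∫ x, Real.exp (u * ((if x then 1 else 0) - r)) ∂(bern r) ≤ Real.exp (r * u ^ 2) := by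
  rw [integral_bern h0 h1]
  have e1 : (1 - r) * Real.exp (u * ((if false then 1 else 0) - r)) +
      r * Real.exp (u * ((if true then 1 else 0) - r)) =
      Real.exp (-(u * r)) * (1 + r * (Real.exp u - 1)) := by
    have : Real.exp (u * (1 - r)) = Real.exp (-(u * r)) * Real.exp u := by
      rw [← Real.exp_add]; ring_nf
    simp only [Bool.false_eq_true, if_false, if_true, this]
    ring_nf
  have h2 : Real.exp u - 1 - u ≤ u ^ 2 :=
    (le_abs_self _).trans (Real.abs_exp_sub_one_sub_id_le hu)
  have h3 : 1 + r * (Real.exp u - 1) ≤ Real.exp (r * (u + u ^ 2)) := by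
    have := Real.add_one_le_exp (r * (u + u ^ 2))
    nlinarith
  simp only at e1
  calc _ = _ := e1
    _ ≤ Real.exp (-(u * r)) * Real.exp (r * (u + u ^ 2)) := by gcongr
    _ = _ := by rw [← Real.exp_add]; ring_nf

/-- The law of a matrix of independent Bernoulli variables with success probabilities `P`. -/
noncomputable def bernMatrix {n : ℕ} (P : Fin n → Fin n → ℝ) : Measure (Fin n → Fin n → Bool) :=
  Measure.pi fun i => Measure.pi fun j => bern (P i j)

lemma bernMatrix_isProbabilityMeasure {n : ℕ} {P : Fin n → Fin n → ℝ}
    (h0 : ∀ i j, 0 ≤ P i j) (h1 : ∀ i j, P i j ≤ 1) : IsProbabilityMeasure (bernMatrix P) := by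
  have := fun i j => bern_isProbabilityMeasure (h0 i j) (h1 i j)
  unfold bernMatrix
  infer_instance

/-- Upper tail of a weighted sum of independent centred Bernoulli variables. -/
lemma bernMatrix_tail {n : ℕ} {P : Fin n → Fin n → ℝ} {p : ℝ}
    (h0 : ∀ i j, 0 ≤ P i j) (h1 : ∀ i j, P i j ≤ 1) (hp : ∀ i j, P i j ≤ p)
    (w : Fin n → Fin n → ℝ) (hw : ∀ i j, |w i j| ≤ 1) {V : ℝ} (hV : ∑ i, ∑ j, w i j ^ 2 ≤ V)
    {t : ℝ} (ht0 : 0 ≤ t) (ht1 : t ≤ 1) (a : ℝ) (hp0 : 0 ≤ p) :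
    (bernMatrix P).real {ω | a ≤ ∑ i, ∑ j, w i j * ((if ω i j then 1 else 0) - P i j)} ≤
      Real.exp (-t * a + p * V * t ^ 2) := by
  have := fun i j => bern_isProbabilityMeasure (h0 i j) (h1 i j)
  have := bernMatrix_isProbabilityMeasure h0 h1
  set f : Fin n → Fin n → Bool → ℝ := fun i j x =>
    Real.exp (t * w i j * ((if x then 1 else 0) - P i j)) with hf
  have hexp : ∀ ω : Fin n → Fin n → Bool,
      Real.exp (t * ∑ i, ∑ j, w i j * ((if ω i j then 1 else 0) - P i j)) =
        ∏ i, ∏ j, f i j (ω i j) := by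
    intro ω
    simp only [hf, ← Real.exp_sum, Finset.mul_sum, mul_assoc]
  have hmgf : mgf (fun ω : Fin n → Fin n → Bool =>
      ∑ i, ∑ j, w i j * ((if ω i j then 1 else 0) - P i j)) (bernMatrix P) t ≤
      Real.exp (p * V * t ^ 2) := by
    unfold mgf
    simp only [hexp]
    rw [bernMatrix, integral_fintype_prod_eq_prod (fun i (x : Fin n → Bool) => ∏ j, f i j (x j))]
    have : ∀ i, ∫ x : Fin n → Bool, ∏ j, f i j (x j) ∂(Measure.pi fun j => bern (P i j)) =
        ∏ j, ∫ x, f i j x ∂(bern (P i j)) := fun i => integral_fintype_prod_eq_prod (f i)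
    simp only [this]
    calc ∏ i, ∏ j, ∫ x, f i j x ∂(bern (P i j))
        ≤ ∏ i, ∏ j, Real.exp (p * t ^ 2 * w i j ^ 2) := by
          refine Finset.prod_le_prod (fun i _ => Finset.prod_nonneg fun j _ =>
            integral_nonneg fun x => (Real.exp_pos _).le) fun i _ => ?_
          refine Finset.prod_le_prod (fun j _ =>
            integral_nonneg fun x => (Real.exp_pos _).le) fun j _ => ?_
          refine (integral_exp_bern_le (h0 i j) (h1 i j) ?_).trans ?_
          · rw [abs_mul, abs_of_nonneg ht0]
            exact mul_le_one₀ ht1 (abs_nonneg _) (hw i j)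
          · refine Real.exp_le_exp.2 ?_
            rw [mul_pow, ← mul_assoc]
            have := hp i j
            gcongr
      _ = Real.exp (p * t ^ 2 * ∑ i, ∑ j, w i j ^ 2) := by
          simp only [← Real.exp_sum, Finset.mul_sum]
      _ ≤ _ := by
          refine Real.exp_le_exp.2 ?_
          rw [mul_right_comm]
          gcongr
  refine (measure_ge_le_exp_mul_mgf a ht0 ?_).trans ?_
  · exact Integrable.of_finite
  · rw [Real.exp_add]
    gcongr

/-- Weights expressing a weighted row sum of `adjM` through the upper-triangular indicators. -/
noncomputable def rowWeight {n : ℕ} (i : Fin n) (ε : Fin n → ℝ) (a b : Fin n) : ℝ :=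
  if a = i then (if i < b then ε b else 0) else if b = i then (if a < i then ε a else 0) else 0

lemma sum_rowWeight_mul {n : ℕ} (i : Fin n) (ε : Fin n → ℝ) (y : Fin n → Fin n → ℝ) :
    ∑ a, ∑ b, rowWeight i ε a b * y a b =
      ∑ j, ε j * (if i = j then 0 else if i ≤ j then y i j else y j i) := by
  have h : ∀ a b, rowWeight i ε a b * y a b =
      (if a = i then (if i < b then ε b else 0) * y i b else 0) +
        (if b = i then (if a < i then ε a else 0) * y a i else 0) := by
    intro a b
    unfold rowWeight
    by_cases ha : a = i
    · subst ha; simp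
    · by_cases hb : b = i
      · subst hb; simp [ha]
      · simp [ha, hb]
  simp only [h, Finset.sum_add_distrib, Finset.sum_ite_eq', Finset.mem_univ, if_true]
  rw [Finset.sum_comm]
  simp only [Finset.sum_ite_eq', Finset.mem_univ, if_true, ← Finset.sum_add_distrib]
  refine Finset.sum_congr rfl fun j _ => ?_
  rcases lt_trichotomy i j with hij | hij | hij
  · simp [hij, hij.le, hij.ne, hij.not_gt]
  · simp [hij]
  · simp [hij, hij.ne', hij.not_ge, hij.not_gt]

lemma abs_rowWeight_le {n : ℕ} (i : Fin n) {ε : Fin n → ℝ} (hε : ∀ j, |ε j| ≤ 1)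
    (a b : Fin n) : |rowWeight i ε a b| ≤ 1 := by
  unfold rowWeight
  split_ifs <;> simp [hε]

lemma sum_rowWeight_sq_le {n : ℕ} (i : Fin n) {ε : Fin n → ℝ} (hε : ∀ j, |ε j| ≤ 1) :
    ∑ a, ∑ b, rowWeight i ε a b ^ 2 ≤ n := by
  simp only [sq (rowWeight _ _ _ _)]
  rw [sum_rowWeight_mul]
  have : ∀ j ∈ Finset.univ, ε j * (if i = j then 0 else if i ≤ j then rowWeight i ε i j
      else rowWeight i ε j i) ≤ 1 := by
    intro j _
    refine (le_abs_self _).trans ?_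
    rw [abs_mul]
    refine mul_le_one₀ (hε j) (abs_nonneg _) ?_
    split_ifs <;> simp [abs_rowWeight_le i hε]
  simpa using Finset.sum_le_card_nsmul _ _ _ this

/-- Upper tail of a weighted row sum of the adjacency matrix. -/
lemma row_tail {n : ℕ} {P : Fin n → Fin n → ℝ} {p : ℝ} (hsymm : ∀ i j, P i j = P j i)
    (h0 : ∀ i j, 0 ≤ P i j) (h1 : ∀ i j, P i j ≤ 1) (hp : ∀ i j, P i j ≤ p) (hp0 : 0 ≤ p)
    (i : Fin n) {ε : Fin n → ℝ} (hε : ∀ j, |ε j| ≤ 1)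
    {t : ℝ} (ht0 : 0 ≤ t) (ht1 : t ≤ 1) (a : ℝ) :
    (bernMatrix P).real {ω | a ≤ (∑ j, ε j * adjM ω i j) - (∑ j, ε j * P i j - ε i * P i i)} ≤
      Real.exp (-t * a + p * n * t ^ 2) := by
  have h := bernMatrix_tail h0 h1 hp (rowWeight i ε) (abs_rowWeight_le i hε)
    (sum_rowWeight_sq_le i hε) ht0 ht1 a hp0
  convert h using 6 with ω
  rw [sum_rowWeight_mul]
  have : ε i * P i i = ∑ j, if i = j then ε j * P i j else 0 := by simp
  rw [this, ← Finset.sum_sub_distrib, ← Finset.sum_sub_distrib]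
  refine Finset.sum_congr rfl fun j _ => ?_
  simp only [adjM, Matrix.of_apply]
  by_cases hij : i = j
  · simp [hij]
  · by_cases hle : i ≤ j
    · simp [hij, hle, mul_sub]
    · simp [hij, hle, mul_sub, hsymm i j]

/-! ### Gaussian linear functionals -/

lemma gauss1_tail {n : ℕ} {σ : ℝ} (v : Fin n → ℝ) {V : ℝ} (hV : ∑ j, v j ^ 2 ≤ V)
    {t : ℝ} (ht0 : 0 ≤ t) (a : ℝ) :
    (gauss1 n σ).real {g | a ≤ ∑ j, v j * g j} ≤
      Real.exp (-t * a + σ ^ 2 * V * t ^ 2 / 2) := by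
  have : IsProbabilityMeasure (gauss1 n σ) := by unfold gauss1; infer_instance
  have hexp : ∀ g : Fin n → ℝ,
      Real.exp (t * ∑ j, v j * g j) = ∏ j, Real.exp ((t * v j) * g j) := by
    intro g
    simp only [← Real.exp_sum, Finset.mul_sum, mul_assoc]
  have hmgf : mgf (fun g : Fin n → ℝ => ∑ j, v j * g j) (gauss1 n σ) t ≤
      Real.exp (σ ^ 2 * V * t ^ 2 / 2) := by
    unfold mgf
    simp only [hexp]
    rw [gauss1, integral_fintype_prod_eq_prod (fun j (x : ℝ) => Real.exp ((t * v j) * x))]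
    have h : ∀ j, ∫ x, Real.exp ((t * v j) * x) ∂(gaussianReal 0 (Real.toNNReal (σ ^ 2))) =
        Real.exp (σ ^ 2 * t ^ 2 / 2 * v j ^ 2) := by
      intro j
      have := mgf_gaussianReal (p := gaussianReal 0 (Real.toNNReal (σ ^ 2)))
        (X := id) Measure.map_id (t * v j)
      rw [Real.coe_toNNReal _ (sq_nonneg σ)] at this
      simp only [mgf, id] at this
      rw [this]
      ring_nf
    simp only [h, ← Real.exp_sum, ← Finset.mul_sum]
    refine Real.exp_le_exp.2 ?_
    calc _ ≤ σ ^ 2 * t ^ 2 / 2 * V := by gcongr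
      _ = _ := by ring
  refine (measure_ge_le_exp_mul_mgf a ht0 ?_).trans ?_
  · simp only [hexp]
    exact Integrable.fintype_prod (f := fun j (x : ℝ) => Real.exp ((t * v j) * x))
      fun j => integrable_exp_mul_gaussianReal _
  · rw [Real.exp_add]
    gcongr

lemma gauss1_abs_tail {n : ℕ} {σ : ℝ} (hσ : 0 < σ) (v : Fin n → ℝ) {V L : ℝ}
    (hV : ∑ j, v j ^ 2 ≤ V) (hV0 : 0 < V) (hL : 0 ≤ L) :
    (gauss1 n σ).real {g | 3 * (σ * √(V * L)) ≤ |∑ j, v j * g j|} ≤ 2 * Real.exp (-(3 * L)) := by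
  have : IsProbabilityMeasure (gauss1 n σ) := by unfold gauss1; infer_instance
  set t := 3 * √L / (σ * √V) with ht
  have hVs : 0 < √V := Real.sqrt_pos.2 hV0
  have ht0 : 0 ≤ t := by positivity
  have hval : -t * (3 * (σ * √(V * L))) + σ ^ 2 * V * t ^ 2 / 2 ≤ -(3 * L) := by
    have h1 : t * (3 * (σ * √(V * L))) = 9 * L := by
      rw [ht, Real.sqrt_mul hV0.le]
      field_simp
      rw [Real.sq_sqrt hL]; ring
    have h2 : σ ^ 2 * V * t ^ 2 = 9 * L := by
      rw [ht, div_pow, mul_pow, mul_pow, Real.sq_sqrt hL, Real.sq_sqrt hV0.le]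
      field_simp
      ring
    linarith
  have hsub : {g : Fin n → ℝ | 3 * (σ * √(V * L)) ≤ |∑ j, v j * g j|} ⊆
      {g | 3 * (σ * √(V * L)) ≤ ∑ j, v j * g j} ∪
        {g | 3 * (σ * √(V * L)) ≤ ∑ j, (-v j) * g j} := by
    intro g hg
    rcases le_abs.1 hg.out with h | h
    · exact Or.inl h
    · right
      simpa [Finset.sum_neg_distrib] using h
  have hA := (gauss1_tail (σ := σ) v hV ht0 (3 * (σ * √(V * L)))).trans (Real.exp_le_exp.2 hval)
  have hB := (gauss1_tail (σ := σ) (fun j => -v j) (by simpa using hV) ht0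
    (3 * (σ * √(V * L)))).trans (Real.exp_le_exp.2 hval)
  have hC := measureReal_mono (μ := gauss1 n σ) hsub
  have hD := measureReal_union_le (μ := gauss1 n σ)
    {g | 3 * (σ * √(V * L)) ≤ ∑ j, v j * g j} {g | 3 * (σ * √(V * L)) ≤ ∑ j, (-v j) * g j}
  linarith

/-! ### Conditioning on a discrete first factor -/

lemma le_prod_of_fiberwise {α β : Type*} [MeasurableSpace α] [MeasurableSpace β] [Countable α]
    [MeasurableSingletonClass α] {μ : Measure α} {ν : Measure β} [IsProbabilityMeasure μ]
    [IsProbabilityMeasure ν] (E : Set α) (F : α → Set β) (hF : ∀ a, MeasurableSet (F a))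
    {δ₁ δ₂ : ℝ} (hδ₁ : μ.real Eᶜ ≤ δ₁) (hδ₂ : ∀ a ∈ E, ν.real (F a)ᶜ ≤ δ₂) (h2 : 0 ≤ δ₂) :
    1 - (δ₁ + δ₂) ≤ (μ.prod ν).real {x | x.1 ∈ E ∧ x.2 ∈ F x.1} := by
  set B : Set (α × β) := {x | x.1 ∈ E ∧ x.2 ∈ (F x.1)ᶜ} with hB
  have hBm : MeasurableSet B := by
    have : B = ⋃ a ∈ E, {a} ×ˢ (F a)ᶜ := by
      ext ⟨a, b⟩
      simp [hB]
    rw [this]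
    exact MeasurableSet.biUnion (Set.to_countable E) fun a _ =>
      (measurableSet_singleton a).prod (hF a).compl
  have hBle : (μ.prod ν).real B ≤ δ₂ := by
    refine ENNReal.toReal_le_of_le_ofReal h2 ?_
    rw [Measure.prod_apply hBm]
    calc ∫⁻ x, ν (Prod.mk x ⁻¹' B) ∂μ ≤ ∫⁻ _, ENNReal.ofReal δ₂ ∂μ := by
          refine lintegral_mono fun a => ?_
          by_cases ha : a ∈ E
          · have : Prod.mk a ⁻¹' B = (F a)ᶜ := by ext b; simp [hB, ha]
            rw [this, ← ofReal_measureReal]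
            exact ENNReal.ofReal_le_ofReal (hδ₂ a ha)
          · have : Prod.mk a ⁻¹' B = ∅ := by ext b; simp [hB, ha]
            simp [this]
      _ = _ := by simp
  have hAle : (μ.prod ν).real (Eᶜ ×ˢ Set.univ) ≤ δ₁ := by
    rw [measureReal_prod_prod]; simpa using hδ₁
  have hcov : (Set.univ : Set (α × β)) ⊆
      {x | x.1 ∈ E ∧ x.2 ∈ F x.1} ∪ (Eᶜ ×ˢ Set.univ ∪ B) := by
    intro x _
    by_cases h1 : x.1 ∈ E <;> by_cases h2 : x.2 ∈ F x.1 <;> simp [hB, h1, h2]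
  have h1 := measureReal_mono (μ := μ.prod ν) hcov
  rw [probReal_univ] at h1
  have h3 := h1.trans (measureReal_union_le _ _)
  have h4 := measureReal_union_le (μ := μ.prod ν) (Eᶜ ×ˢ Set.univ) B
  linarith

/-! ### The block structure -/

/-- The class labels `±1`. -/
noncomputable def label (n : ℕ) (i : Fin n) : ℝ := if (i : ℕ) < n / 2 then 1 else -1

/-- The edge probabilities of the 2-block model. -/
noncomputable def blockProb (n : ℕ) (p q : ℝ) (i j : Fin n) : ℝ :=
  if ((i : ℕ) < n / 2 ↔ (j : ℕ) < n / 2) then p else q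

lemma label_eq_one_or_neg_one {n : ℕ} (i : Fin n) : label n i = 1 ∨ label n i = -1 := by
  unfold label
  split_ifs <;> simp

lemma abs_label {n : ℕ} (i : Fin n) : |label n i| = 1 := by
  rcases label_eq_one_or_neg_one i with h | h <;> simp [h]

lemma sig_eq {n : ℕ} (i : Fin n) : sig n i = label n i * (√n)⁻¹ := by
  unfold sig label
  split_ifs <;> simp

lemma sum_label {n : ℕ} (hn : Even n) : ∑ i, label n i = 0 := by
  obtain ⟨m, rfl⟩ := hn
  have h : (m + m) / 2 = m := by omega
  simp [Fin.sum_univ_add, label, h]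

lemma blockProb_eq {n : ℕ} (p q : ℝ) (i j : Fin n) :
    blockProb n p q i j = (p + q) / 2 + label n i * label n j * ((p - q) / 2) := by
  unfold blockProb label
  by_cases hi : (i : ℕ) < n / 2 <;> by_cases hj : (j : ℕ) < n / 2 <;> simp [hi, hj] <;> ring

lemma sum_label_mul_blockProb {n : ℕ} (hn : Even n) (p q : ℝ) (i : Fin n) :
    ∑ j, label n j * blockProb n p q i j = label n i * (n * (p - q) / 2) := by
  have h : ∀ j, label n j * blockProb n p q i j =
      (p + q) / 2 * label n j + label n i * ((p - q) / 2) := by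
    intro j
    rw [blockProb_eq]
    rcases label_eq_one_or_neg_one j with hj | hj <;> rw [hj] <;> ring
  simp only [h, Finset.sum_add_distrib, ← Finset.mul_sum, sum_label hn, Finset.sum_const,
    Finset.card_univ, Fintype.card_fin, nsmul_eq_mul]
  ring

lemma adjM_eq_zero_or_one {n : ℕ} (ω : Fin n → Fin n → Bool) (i j : Fin n) :
    adjM ω i j = 0 ∨ adjM ω i j = 1 := by
  simp only [adjM, Matrix.of_apply]
  by_cases hij : i = j
  · simp [hij]
  · simp only [hij, if_false]
    generalize (if i ≤ j then ω i j else ω j i) = b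
    cases b <;> simp

lemma adjM_nonneg {n : ℕ} (ω : Fin n → Fin n → Bool) (i j : Fin n) : 0 ≤ adjM ω i j := by
  rcases adjM_eq_zero_or_one ω i j with h | h <;> simp [h]

lemma avgDeg_nonneg {n : ℕ} (ω : Fin n → Fin n → Bool) : 0 ≤ avgDeg ω :=
  div_nonneg (Finset.sum_nonneg fun i _ => Finset.sum_nonneg fun j _ => adjM_nonneg ω i j)
    n.cast_nonneg

lemma avgDeg_le {n : ℕ} (ω : Fin n → Fin n → Bool) {Δ : ℝ} (hn : 0 < n)
    (h : ∀ i, ∑ j, adjM ω i j ≤ Δ) : avgDeg ω ≤ Δ := by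
  have hn' : (0 : ℝ) < n := by exact_mod_cast hn
  rw [avgDeg, div_le_iff₀ hn']
  have := Finset.sum_le_card_nsmul Finset.univ _ _ fun i _ => h i
  simpa [mul_comm] using this

lemma sum_adjM_sub_sq_le {n : ℕ} (ω : Fin n → Fin n → Bool) {p : ℝ} (hn : 0 < n) (hp0 : 0 ≤ p)
    (hp1 : p ≤ 1) (h : ∀ i, ∑ j, adjM ω i j ≤ 5 * (n * p)) (i : Fin n) :
    ∑ j, (adjM ω i j - avgDeg ω / n) ^ 2 ≤ 30 * (n * p) := by
  have hn' : (0 : ℝ) < n := by exact_mod_cast hn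
  have hd0 := avgDeg_nonneg ω
  have hd := avgDeg_le ω hn h
  have h1 : ∀ j ∈ Finset.univ, (adjM ω i j - avgDeg ω / n) ^ 2 ≤
      adjM ω i j + (avgDeg ω / n) ^ 2 := by
    intro j _
    have : 0 ≤ avgDeg ω / n := by positivity
    rcases adjM_eq_zero_or_one ω i j with h | h <;> rw [h] <;> nlinarith
  refine (Finset.sum_le_sum h1).trans ?_
  rw [Finset.sum_add_distrib]
  have h2 : avgDeg ω / n ≤ 5 * p := by
    rw [div_le_iff₀ hn']; linarith
  have h3 : (avgDeg ω / n) ^ 2 ≤ (5 * p) ^ 2 := by gcongr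
  have h4 : (5 * p) ^ 2 ≤ 25 * p := by nlinarith
  have h5 := h i
  simp only [Finset.sum_const, Finset.card_univ, Fintype.card_fin, nsmul_eq_mul]
  have h6 : n * (avgDeg ω / n) ^ 2 ≤ n * (25 * p) := by gcongr; linarith
  linarith

/-- The deterministic part of the argument: row concentration of the graph together with small
noise sums gives the entrywise bound. -/
lemma convolution_error_le {n : ℕ} {p q σ L : ℝ} (hn : 0 < n) (hq : 0 ≤ q) (hqp : q < p)
    (hp1 : p ≤ 1) (hσ : 0 < σ) (hL : 1 ≤ L) (hLp : L ≤ n * p) (heven : Even n)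
    (hγ : 20 * √(L / (n * p)) ≤ (p - q) / (p + q))
    (ω : Fin n → Fin n → Bool) (g : Fin n → ℝ)
    (hR : ∀ i, |∑ j, label n j * adjM ω i j - label n i * (n * (p - q) / 2 - p)| ≤
      4 * √(n * p * L))
    (hG : ∀ i, |∑ j, (adjM ω i j - avgDeg ω / n) * g j| ≤ 3 * (σ * √(30 * (n * p) * L)))
    (i : Fin n) :
    |sig n i - ((p - q) * n / (2 * avgDeg ω))⁻¹ *
        ((tildeA ω).mulVec fun j => sig n j + g j) i| ≤
      36 * (σ * (((p - q) / (p + q))⁻¹ * √(L / (n * p)) + √(L / n))) + 1 / (2 * √n) := by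
  have hn' : (0 : ℝ) < n := by exact_mod_cast hn
  have hp : 0 < p := by linarith
  have hnp : 0 < n * p := by positivity
  set X := √(n * p * L) with hX
  set D := (p - q) * n with hDdef
  have hD : 0 < D := mul_pos (by linarith) hn'
  have hX1 : 1 ≤ X := by
    rw [hX, Real.one_le_sqrt]
    nlinarith
  have hsq : √(L / (n * p)) = X / (n * p) := by
    rw [hX, Real.sqrt_mul hnp.le, Real.sqrt_div (by linarith)]
    field_simp
    rw [Real.sq_sqrt hnp.le]
  have hDX : 20 * X ≤ D := by
    rw [hsq, le_div_iff₀ (by linarith)] at hγ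
    have h1 : 20 * (X / (n * p)) * p ≤ p - q := by
      refine le_trans ?_ hγ
      gcongr
      linarith
    have h2 : 20 * (X / (n * p)) * p = 20 * X / n := by field_simp
    rw [h2, div_le_iff₀ hn'] at h1
    exact h1
  have hd : avgDeg ω ≠ 0 := by
    intro h0
    have hz : ∑ i, ∑ j, adjM ω i j = 0 := by
      rcases div_eq_zero_iff.1 h0 with h | h
      · exact h
      · exact absurd h hn'.ne'
    have hz1 := (Finset.sum_eq_zero_iff_of_nonneg fun i _ =>
      Finset.sum_nonneg fun j _ => adjM_nonneg ω i j).1 hz i (Finset.mem_univ i)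
    have hz2 := (Finset.sum_eq_zero_iff_of_nonneg fun j _ => adjM_nonneg ω i j).1 hz1
    have hz3 : ∑ j, label n j * adjM ω i j = 0 :=
      Finset.sum_eq_zero fun j hj => by rw [hz2 j hj, mul_zero]
    have := hR i
    rw [hz3, zero_sub, abs_neg, abs_mul, abs_label, one_mul] at this
    have := (le_abs_self _).trans this
    linarith
  set R := ∑ j, label n j * adjM ω i j with hRdef
  set G := ∑ j, (adjM ω i j - avgDeg ω / n) * g j with hGdef
  have hs : 0 < √(n : ℝ) := Real.sqrt_pos.2 hn'
  have hmul : (D / (2 * avgDeg ω))⁻¹ * ((tildeA ω).mulVec fun j => sig n j + g j) i =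
      2 / D * (R * (√n)⁻¹ + G) := by
    have h1 : ((tildeA ω).mulVec fun j => sig n j + g j) i =
        (avgDeg ω)⁻¹ * (R * (√n)⁻¹ + G) := by
      have h2 : ∀ j, tildeA ω i j * (sig n j + g j) =
          (avgDeg ω)⁻¹ * (label n j * adjM ω i j * (√n)⁻¹ +
            (adjM ω i j - avgDeg ω / n) * g j) - (n : ℝ)⁻¹ * (√n)⁻¹ * label n j := by
        intro j
        rw [sig_eq]
        simp only [tildeA, Matrix.sub_apply, Matrix.smul_apply, Matrix.of_apply, smul_eq_mul]
        field_simp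
        ring
      simp only [Matrix.mulVec, dotProduct, h2]
      rw [Finset.sum_sub_distrib, ← Finset.mul_sum, ← Finset.mul_sum, sum_label heven,
        Finset.sum_add_distrib, ← Finset.sum_mul]
      ring
    rw [h1]
    field_simp
  rw [hmul, sig_eq]
  have hsplit : label n i * (√n)⁻¹ - 2 / D * (R * (√n)⁻¹ + G) =
      -((R - label n i * (n * (p - q) / 2 - p)) - label n i * p) * (2 / D * (√n)⁻¹) -
        2 / D * G := by
    have : D / 2 = n * (p - q) / 2 := by rw [hDdef]; ring
    rw [← this]
    field_simp
    ring
  rw [hsplit]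
  have hsig : |-((R - label n i * (n * (p - q) / 2 - p)) - label n i * p) * (2 / D * (√n)⁻¹)| ≤
      1 / (2 * √n) := by
    rw [abs_mul, abs_neg, abs_of_pos (show 0 < 2 / D * (√n)⁻¹ by positivity)]
    have h1 : |(R - label n i * (n * (p - q) / 2 - p)) - label n i * p| ≤ D / 4 := by
      refine (abs_sub _ _).trans ?_
      rw [abs_mul, abs_label, one_mul, abs_of_pos hp]
      linarith [hR i]
    calc _ ≤ D / 4 * (2 / D * (√n)⁻¹) := by gcongr
      _ = _ := by field_simp; norm_num
  have hnoise : |2 / D * G| ≤ 36 * (σ * (((p - q) / (p + q))⁻¹ * √(L / (n * p)) + √(L / n))) := by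
    have h30 : √(30 * (n * p) * L) ≤ 6 * X := by
      rw [show 30 * (n * p) * L = 30 * (n * p * L) by ring, Real.sqrt_mul (by norm_num)]
      gcongr
      rw [Real.sqrt_le_left (by norm_num)]
      norm_num
    have h1 : X / D ≤ ((p - q) / (p + q))⁻¹ * √(L / (n * p)) := by
      have hpq : 0 < p - q := by linarith
      rw [hsq, hDdef, inv_div, div_mul_div_comm, div_le_div_iff₀ (by positivity) (by positivity)]
      have : 0 ≤ X * (p - q) * n * q := by positivity
      nlinarith
    rw [abs_mul, abs_of_pos (show 0 < 2 / D by positivity)]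
    calc 2 / D * |G| ≤ 2 / D * (3 * (σ * (6 * X))) := by
          gcongr
          refine (hG i).trans ?_
          gcongr
      _ = 36 * (σ * (X / D)) := by ring
      _ ≤ _ := by
          gcongr
          linarith [Real.sqrt_nonneg (L / n)]
  refine (abs_sub _ _).trans ?_
  linarith

/-- Row concentration of the stochastic block model. -/
lemma sbm_row_concentration {n : ℕ} {p q L : ℝ} (heven : Even n) (hq : 0 ≤ q)
    (hqp : q < p) (hp1 : p ≤ 1) (hL : 0 ≤ L) (hLp : L ≤ n * p) (hnp : 0 < n * p) :
    (sbm n p q).real {ω | ∀ i,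
      |∑ j, label n j * adjM ω i j - label n i * (n * (p - q) / 2 - p)| ≤ 4 * √(n * p * L) ∧
        ∑ j, adjM ω i j ≤ 5 * (n * p)}ᶜ ≤ n * (3 * Real.exp (-(3 * L))) := by
  set P := blockProb n p q with hP
  have hp0 : 0 ≤ p := by linarith
  have h0 : ∀ i j, 0 ≤ P i j := fun i j => by simp only [hP, blockProb]; split_ifs <;> linarith
  have hp : ∀ i j, P i j ≤ p := fun i j => by simp only [hP, blockProb]; split_ifs <;> linarith
  have h1 : ∀ i j, P i j ≤ 1 := fun i j => (hp i j).trans hp1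
  have hsymm : ∀ i j, P i j = P j i := fun i j => by simp only [hP, blockProb, iff_comm]
  have hdiag : ∀ i, P i i = p := fun i => by simp [hP, blockProb]
  have hsbm : sbm n p q = bernMatrix P := rfl
  have := bernMatrix_isProbabilityMeasure h0 h1
  rw [hsbm]
  set X := √(n * p * L) with hX
  set t := √(L / (n * p)) with ht
  have ht0 : 0 ≤ t := Real.sqrt_nonneg _
  have ht1 : t ≤ 1 := by
    rw [ht, Real.sqrt_le_left zero_le_one, one_pow, div_le_one hnp]
    exact hLp
  have hXle : X ≤ n * p := by
    rw [hX, Real.sqrt_le_left hnp.le]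
    nlinarith
  have hexp : -t * (4 * X) + p * n * t ^ 2 = -(3 * L) := by
    have e1 : t * X = L := by
      rw [ht, hX, ← Real.sqrt_mul (by positivity), show L / (n * p) * (n * p * L) = L ^ 2 by
        rw [← mul_assoc, div_mul_cancel₀ _ hnp.ne', sq], Real.sqrt_sq hL]
    have e2 : p * n * t ^ 2 = L := by
      rw [ht, Real.sq_sqrt (by positivity), mul_comm p, mul_div_cancel₀ _ hnp.ne']
    linarith
  have hrow := fun (i : Fin n) (ε : Fin n → ℝ) (hε : ∀ j, |ε j| ≤ 1) =>
    row_tail hsymm h0 h1 hp hp0 i hε ht0 ht1 (4 * X)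
  simp only [hexp] at hrow
  set S : (Fin n → ℝ) → Fin n → Set (Fin n → Fin n → Bool) := fun ε i =>
    {ω | 4 * X ≤ (∑ j, ε j * adjM ω i j) - (∑ j, ε j * P i j - ε i * P i i)} with hS
  have hsub : {ω : Fin n → Fin n → Bool | ∀ i,
      |∑ j, label n j * adjM ω i j - label n i * (n * (p - q) / 2 - p)| ≤ 4 * X ∧
        ∑ j, adjM ω i j ≤ 5 * (n * p)}ᶜ ⊆
      ⋃ i, ((S (label n) i ∪ S (fun j => -label n j) i) ∪ S (fun _ => 1) i) := by
    intro ω hω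
    simp only [Set.mem_compl_iff, Set.mem_ofPred_eq, not_forall, not_and_or, not_le] at hω
    obtain ⟨i, hi⟩ := hω
    refine Set.mem_iUnion.2 ⟨i, ?_⟩
    rcases hi with hi | hi
    · left
      rcases lt_abs.1 hi with h | h
      · left
        simp only [hS, Set.mem_ofPred_eq, hdiag]
        rw [hP, sum_label_mul_blockProb heven]
        linarith
      · right
        simp only [hS, Set.mem_ofPred_eq, hdiag, neg_mul, Finset.sum_neg_distrib]
        rw [hP, sum_label_mul_blockProb heven]
        linarith
    · right
      simp only [hS, Set.mem_ofPred_eq, one_mul]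
      have : ∑ j, P i j ≤ n * p := by
        simpa using Finset.sum_le_card_nsmul Finset.univ _ _ fun j _ => hp i j
      linarith [h0 i i]
  refine (measureReal_mono hsub).trans ((measureReal_iUnion_fintype_le _).trans ?_)
  have hterm : ∀ i ∈ Finset.univ, (bernMatrix P).real
      ((S (label n) i ∪ S (fun j => -label n j) i) ∪ S (fun _ => 1) i) ≤
      3 * Real.exp (-(3 * L)) := by
    intro i _
    have a1 := hrow i (label n) fun j => (abs_label j).le
    have a2 := hrow i (fun j => -label n j) fun j => by rw [abs_neg, abs_label]
    have a3 := hrow i (fun _ => 1) fun j => by simp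
    have b1 := measureReal_union_le (μ := bernMatrix P) (S (label n) i) (S (fun j => -label n j) i)
    have b2 := measureReal_union_le (μ := bernMatrix P)
      (S (label n) i ∪ S (fun j => -label n j) i) (S (fun _ => 1) i)
    linarith
  simpa using Finset.sum_le_card_nsmul _ _ _ hterm

lemma gauss1_forall_tail {ι : Type*} [Fintype ι] {n : ℕ} {σ : ℝ} (hσ : 0 < σ)
    (v : ι → Fin n → ℝ) {V L : ℝ} (hV : ∀ i, ∑ j, v i j ^ 2 ≤ V) (hV0 : 0 < V) (hL : 0 ≤ L) :
    (gauss1 n σ).real {g | ∀ i, |∑ j, v i j * g j| ≤ 3 * (σ * √(V * L))}ᶜ ≤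
      Fintype.card ι * (2 * Real.exp (-(3 * L))) := by
  have : IsProbabilityMeasure (gauss1 n σ) := by unfold gauss1; infer_instance
  have hsub : {g : Fin n → ℝ | ∀ i, |∑ j, v i j * g j| ≤ 3 * (σ * √(V * L))}ᶜ ⊆
      ⋃ i, {g | 3 * (σ * √(V * L)) ≤ |∑ j, v i j * g j|} := by
    intro g hg
    simp only [Set.mem_compl_iff, Set.mem_ofPred_eq, not_forall, not_le] at hg
    obtain ⟨i, hi⟩ := hg
    exact Set.mem_iUnion.2 ⟨i, hi.le⟩
  refine (measureReal_mono hsub).trans ((measureReal_iUnion_fintype_le _).trans ?_)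
  simpa using Finset.sum_le_card_nsmul Finset.univ _ _ fun i _ =>
    gauss1_abs_tail hσ (v i) (hV i) hV0 hL

/-- Centered 1-dimensional 2-block CSBM with `p ≥ Ω(log²n/n)`,
`γ ≥ Ω(√(log n/(np)))` and `σ ≤ O(1/√n)`: with probability `1 - n^{-Ω(1)}`, the single
convolution `x₁ = Ã x` of `x = s + g` satisfies
`‖s - (1/η)x₁‖_∞ ≤ O(σ((1/γ)√(log n/(np)) + √(log n/n))) + 1/(2√n)`,
where `η = (p-q)n/(2d)`. -/
theorem exact_recovery_one_convolution :
    ∃ (C₁ C₂ C₃ c : ℝ) (n₀ : ℕ), 0 < C₁ ∧ 0 < C₂ ∧ 0 < C₃ ∧ 0 < c ∧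
      ∀ (n : ℕ) (p q σ : ℝ),
        n₀ ≤ n → Even n → 0 ≤ q → q < p → p ≤ 1 → 0 < σ →
        C₁ * (Real.log n) ^ 2 / n ≤ p →
        C₁ * Real.sqrt (Real.log n / (n * p)) ≤ (p - q) / (p + q) →
        σ ≤ C₃ / Real.sqrt n →
        ENNReal.ofReal (1 - (n : ℝ) ^ (-c)) ≤
          ((sbm n p q).prod (gauss1 n σ))
            {ω | ∀ i : Fin n,
              |sig n i - ((p - q) * n / (2 * avgDeg ω.1))⁻¹ *
                  ((tildeA ω.1).mulVec fun j => sig n j + ω.2 j) i| ≤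
                C₂ * (σ * ((((p - q) / (p + q)))⁻¹ * Real.sqrt (Real.log n / (n * p)) +
                    Real.sqrt (Real.log n / n))) +
                  1 / (2 * Real.sqrt n)} := by
  refine ⟨20, 36, 1, 1, 5, by norm_num, by norm_num, by norm_num, by norm_num, ?_⟩
  intro n p q σ hn heven hq hqp hp1 hσ hlog hγ _
  have hn5 : (5 : ℝ) ≤ n := by exact_mod_cast hn
  have hn0 : (0 : ℝ) < n := by linarith
  have hnpos : 0 < n := by omega
  have hp0 : 0 < p := by linarith
  have hnp : 0 < n * p := by positivity
  set L := Real.log n with hLdef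
  have hL : 1 ≤ L := by
    rw [hLdef, Real.le_log_iff_exp_le hn0]
    linarith [Real.exp_one_lt_d9]
  have hLp : L ≤ n * p := by
    rw [div_le_iff₀ hn0] at hlog
    nlinarith
  have hE := sbm_row_concentration heven hq hqp hp1 (by linarith : 0 ≤ L) hLp hnp
  set E : Set (Fin n → Fin n → Bool) := {ω | ∀ i,
    |∑ j, label n j * adjM ω i j - label n i * (n * (p - q) / 2 - p)| ≤ 4 * √(n * p * L) ∧
      ∑ j, adjM ω i j ≤ 5 * (n * p)} with hEdef
  set F : (Fin n → Fin n → Bool) → Set (Fin n → ℝ) := fun ω =>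
    {g | ∀ i, |∑ j, (adjM ω i j - avgDeg ω / n) * g j| ≤ 3 * (σ * √(30 * (n * p) * L))} with hFdef
  have hF : ∀ ω, MeasurableSet (F ω) := fun ω => by
    simp only [hFdef, Set.ofPred_forall]
    exact MeasurableSet.iInter fun i => measurableSet_le (by fun_prop) measurable_const
  have hFle : ∀ ω ∈ E, (gauss1 n σ).real (F ω)ᶜ ≤ n * (2 * Real.exp (-(3 * L))) := by
    intro ω hω
    simpa using gauss1_forall_tail hσ (fun i j => adjM ω i j - avgDeg ω / n)
      (sum_adjM_sub_sq_le ω hnpos hp0.le hp1 fun i => (hω i).2)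
      (by positivity) (by linarith : 0 ≤ L)
  have : IsProbabilityMeasure (gauss1 n σ) := by unfold gauss1; infer_instance
  have : IsProbabilityMeasure (sbm n p q) :=
    bernMatrix_isProbabilityMeasure (P := blockProb n p q)
      (fun i j => by simp only [blockProb]; split_ifs <;> linarith)
      (fun i j => by simp only [blockProb]; split_ifs <;> linarith)
  have hmain := le_prod_of_fiberwise E F hF hE hFle (by positivity)
  have hexp : Real.exp (-(3 * L)) = ((n : ℝ) ^ 3)⁻¹ := by
    rw [Real.exp_neg, hLdef, show 3 * Real.log n = ((3 : ℕ) : ℝ) * Real.log n by norm_num,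
      Real.exp_nat_mul, Real.exp_log hn0]
  have hprob : 1 - (n : ℝ) ^ (-(1 : ℝ)) ≤
      1 - (n * (3 * Real.exp (-(3 * L))) + n * (2 * Real.exp (-(3 * L)))) := by
    rw [hexp, Real.rpow_neg_one]
    have : n * (3 * ((n : ℝ) ^ 3)⁻¹) + n * (2 * ((n : ℝ) ^ 3)⁻¹) = 5 / n * (n : ℝ)⁻¹ := by
      field_simp
      norm_num
    rw [this]
    have h5 : 5 / (n : ℝ) ≤ 1 := by rwa [div_le_one hn0]
    have : 0 ≤ (n : ℝ)⁻¹ := by positivity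
    nlinarith
  refine (ENNReal.ofReal_le_ofReal (hprob.trans hmain)).trans ?_
  rw [ofReal_measureReal]
  refine measure_mono ?_
  rintro ⟨ω, g⟩ ⟨hω, hg⟩ i
  exact convolution_error_le hnpos hq hqp hp1 hσ hL hLp heven hγ ω g (fun i => (hω i).1) hg i
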